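/- Let Ω ⊊ ℝ^m be a domain and let E ⊂ Ω be a closed subset of Ω of Lebesgue measure zero. If the function x ↦ -log(d_{∂Ω}(x)) is subharmonic on Ω \ E, then it is subharmonic on all of Ω. -/

import Mathlib

open MeasureTheory Metric Filter Topology Set
open scoped ENNReal

noncomputable section

/-- The positive part of an extended real number, as an extended nonnegative real. -/
def erealToENNReal (x : EReal) : ℝ≥0∞ := if x = ⊤ then ⊤ else ENNReal.ofReal x.toReal

variable {E : Type*} [NormedAddCommGroup E] [MeasureSpace E]

/-- The mean value `M_u(x,r)` of an extended-real-valued function `u` over the ball `B(x,r)`,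
computed as the difference of the integrals of the positive and negative parts. -/
def erealBallAvg (u : E → EReal) (x : E) (r : ℝ) : EReal :=
  (((∫⁻ y in ball x r, erealToENNReal (u y)) / volume (ball x r) : ℝ≥0∞) : EReal)
    - (((∫⁻ y in ball x r, erealToENNReal (-(u y))) / volume (ball x r) : ℝ≥0∞) : EReal)

/-- The sub-mean value property on a set `s`: at each point of `s` the value of `u` is at most
its average over every sufficiently small ball centered at the point and contained in `s`. -/
def SubmeanOn (u : E → EReal) (s : Set E) : Prop :=
  ∀ x ∈ s, ∃ R > 0, ∀ r : ℝ, 0 < r → r < R → closedBall x r ⊆ s →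
    u x ≤ erealBallAvg u x r

/-- `u : E → [-∞,∞)` is subharmonic on `s` if it is upper semicontinuous on `s`, not
identically `-∞` on `s`, takes values in `[-∞,∞)`, and satisfies the sub-mean value
inequality on `s`. -/
def IsSubharmonicOn (u : E → EReal) (s : Set E) : Prop :=
  UpperSemicontinuousOn u s ∧ (¬ ∀ x ∈ s, u x = ⊥) ∧ (∀ x ∈ s, u x < ⊤) ∧ SubmeanOn u s

section BallIncrement

open Convolution

variable {V : Type*} [NormedAddCommGroup V]

lemma lipschitzWith_one_sub_min_norm_sq :
    LipschitzWith 2 (fun y : V => 1 - (min ‖y‖ 1) ^ 2) := by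
  refine LipschitzWith.of_dist_le_mul fun x y => ?_
  have h : |min ‖x‖ 1 - min ‖y‖ 1| ≤ dist x y := by
    have := (LipschitzWith.min_const (lipschitzWith_one_norm (E := V)) 1).dist_le_mul x y
    simpa [Real.dist_eq] using this
  have hx : 0 ≤ min ‖x‖ 1 := by positivity
  have hy : 0 ≤ min ‖y‖ 1 := by positivity
  have hx1 : min ‖x‖ 1 ≤ 1 := min_le_right _ _
  have hy1 : min ‖y‖ 1 ≤ 1 := min_le_right _ _
  rw [Real.dist_eq]
  have e : 1 - (min ‖x‖ 1) ^ 2 - (1 - (min ‖y‖ 1) ^ 2)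
      = -((min ‖x‖ 1 + min ‖y‖ 1) * (min ‖x‖ 1 - min ‖y‖ 1)) := by ring
  rw [e, abs_neg, abs_mul, abs_of_nonneg (add_nonneg hx hy)]
  have : min ‖x‖ 1 + min ‖y‖ 1 ≤ 2 := by linarith
  simpa using mul_le_mul this h (abs_nonneg _) (by norm_num)

variable [InnerProductSpace ℝ V]

lemma lineDeriv_one_sub_min_norm_sq (x e : V) (hx : ‖x‖ ≠ 1) :
    lineDeriv ℝ (fun y : V => 1 - (min ‖y‖ 1) ^ 2) x (-e)
      = (ball (0 : V) 1).indicator (fun y => 2 * inner ℝ y e) x := by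
  rcases lt_or_gt_of_ne hx with h | h
  · rw [indicator_of_mem (by simpa using h)]
    have hd : HasFDerivAt (fun y : V => 1 - ‖y‖ ^ 2) (-(2 • innerSL ℝ x)) x := by
      simpa using (hasStrictFDerivAt_norm_sq x).hasFDerivAt.const_sub 1
    have hev : (fun y : V => 1 - (min ‖y‖ 1) ^ 2) =ᶠ[𝓝 x] (fun y : V => 1 - ‖y‖ ^ 2) := by
      filter_upwards [continuous_norm.continuousAt.eventually (gt_mem_nhds h)] with y hy
      rw [min_eq_left hy.le]
    rw [((hd.congr_of_eventuallyEq hev).hasLineDerivAt (-e)).lineDeriv]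
    simp
  · rw [indicator_of_notMem (by simpa using h.le)]
    have hev : (fun y : V => 1 - (min ‖y‖ 1) ^ 2) =ᶠ[𝓝 x] (fun y : V => (0 : ℝ)) := by
      filter_upwards [continuous_norm.continuousAt.eventually (lt_mem_nhds h)] with y hy
      rw [min_eq_right hy.le]; norm_num
    rw [(((hasFDerivAt_const (0 : ℝ) x).congr_of_eventuallyEq hev).hasLineDerivAt (-e)).lineDeriv]
    simp

lemma ContDiff.fderiv_const_apply {v : V → ℝ} (hv : ContDiff ℝ 2 v) (e : V) :
    ContDiff ℝ 1 (fun y => fderiv ℝ v y e) :=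
  (hv.fderiv_right (m := 1) (by norm_num)).clm_apply contDiff_const

variable [FiniteDimensional ℝ V]

/-- The trace of the second derivative, in an orthonormal basis. -/
def traceHessian (v : V → ℝ) (x : V) : ℝ :=
  ∑ i, fderiv ℝ (fun y => fderiv ℝ v y (stdOrthonormalBasis ℝ V i)) x (stdOrthonormalBasis ℝ V i)

lemma continuous_traceHessian {v : V → ℝ} (hv : ContDiff ℝ 2 v) :
    Continuous (traceHessian v) := by
  unfold traceHessian
  refine continuous_finsetSum _ fun i _ => ?_
  exact ((hv.fderiv_const_apply _).continuous_fderiv (by simp)).clm_apply continuous_const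

lemma traceHessian_neg (v : V → ℝ) (x : V) :
    traceHessian (fun y => -v y) x = -traceHessian v x := by
  simp [traceHessian, fderiv_fun_neg]

variable [MeasurableSpace V] [BorelSpace V] {μ : Measure V} [μ.IsAddHaarMeasure]

/-- The integral of `y ↦ f (z + r • y) - f z` over the unit ball; up to normalization, this is the
difference between the mean of `f` over `ball z r` and `f z`. -/
def ballIncrement (μ : Measure V) (f : V → ℝ) (z : V) (r : ℝ) : ℝ :=
  ∫ y in ball (0 : V) 1, (f (z + r • y) - f z) ∂μ

lemma integral_ball_mul_inner {w : V → ℝ} (hw : ContDiff ℝ 1 w) (hc : HasCompactSupport w)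
    (e : V) :
    ∫ y in ball (0 : V) 1, w y * inner ℝ y e ∂μ
      = 2⁻¹ * ∫ y in ball (0 : V) 1, fderiv ℝ w y e * (1 - ‖y‖ ^ 2) ∂μ := by
  obtain ⟨C, hC⟩ : ∃ C, LipschitzWith C w :=
    ContDiff.lipschitzWith_of_hasCompactSupport hc hw (by simp)
  have hcg : HasCompactSupport (fun y : V => 1 - (min ‖y‖ 1) ^ 2) := by
    refine HasCompactSupport.intro (isCompact_closedBall (0 : V) 1) fun x hx => ?_
    have : 1 < ‖x‖ := by simpa using hx
    rw [min_eq_right this.le]; norm_num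
  have key := LipschitzWith.integral_lineDeriv_mul_eq (μ := μ) hC
    lipschitzWith_one_sub_min_norm_sq hcg e
  have h1 : ∫ x, lineDeriv ℝ w x e * (1 - (min ‖x‖ 1) ^ 2) ∂μ
      = ∫ y in ball (0 : V) 1, fderiv ℝ w y e * (1 - ‖y‖ ^ 2) ∂μ := by
    rw [← integral_indicator measurableSet_ball]
    congr 1
    ext x
    rw [((hw.differentiable (by simp)) x).lineDeriv_eq_fderiv]
    by_cases hx : ‖x‖ < 1
    · rw [indicator_of_mem (by simpa using hx), min_eq_left hx.le]
    · rw [indicator_of_notMem (by simpa using hx), min_eq_right (not_lt.1 hx)]; simp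
  have h2 : ∫ x, lineDeriv ℝ (fun y : V => 1 - (min ‖y‖ 1) ^ 2) x (-e) * w x ∂μ
      = 2 * ∫ y in ball (0 : V) 1, w y * inner ℝ y e ∂μ := by
    rw [← integral_indicator measurableSet_ball, ← integral_const_mul]
    refine integral_congr_ae ?_
    have hs : ∀ᵐ x ∂μ, x ∉ sphere (0 : V) 1 :=
      measure_eq_zero_iff_ae_notMem.1 (Measure.addHaar_sphere_of_ne_zero μ 0 one_ne_zero)
    filter_upwards [hs] with x hx
    rw [lineDeriv_one_sub_min_norm_sq x e (by simpa using hx)]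
    by_cases h : x ∈ ball (0 : V) 1
    · simp only [indicator_of_mem h]; ring
    · simp only [indicator_of_notMem h]; ring
  rw [h1, h2] at key
  linarith

lemma integrableOn_ball_of_continuous {f : V → ℝ} (hf : Continuous f) (z : V) (r : ℝ) :
    IntegrableOn f (ball z r) μ :=
  (hf.locallyIntegrable.integrableOn_isCompact (isCompact_closedBall z r)).mono_set
    ball_subset_closedBall

lemma integral_ball_fderiv_apply {v : V → ℝ} (hv : ContDiff ℝ 2 v) (hc : HasCompactSupport v)
    (z : V) {r : ℝ} (hr : r ≠ 0) :
    ∫ y in ball (0 : V) 1, fderiv ℝ v (z + r • y) y ∂μ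
      = r / 2 * ∫ y in ball (0 : V) 1, traceHessian v (z + r • y) * (1 - ‖y‖ ^ 2) ∂μ := by
  set b := stdOrthonormalBasis ℝ V
  have haff : ContDiff ℝ 1 (fun y : V => z + r • y) := by fun_prop
  have hcomp : ∀ i, ContDiff ℝ 1 (fun y : V => fderiv ℝ v (z + r • y) (b i)) := fun i =>
    (hv.fderiv_const_apply (b i)).comp haff
  have h1 : ∀ y : V, fderiv ℝ v (z + r • y) y
      = ∑ i, fderiv ℝ v (z + r • y) (b i) * inner ℝ y (b i) := fun y => by
    conv_lhs => rw [← b.sum_repr' y]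
    rw [map_sum, b.sum_repr']
    refine Finset.sum_congr rfl fun i _ => ?_
    rw [map_smul, smul_eq_mul, mul_comm, real_inner_comm]
  have h2 : ∀ i, ∫ y in ball (0 : V) 1, fderiv ℝ v (z + r • y) (b i) * inner ℝ y (b i) ∂μ
      = 2⁻¹ * ∫ y in ball (0 : V) 1,
        r * fderiv ℝ (fun y => fderiv ℝ v y (b i)) (z + r • y) (b i) * (1 - ‖y‖ ^ 2) ∂μ := by
    intro i
    have hcs : HasCompactSupport (fun y : V => fderiv ℝ v (z + r • y) (b i)) := by
      have h := hc.fderiv_apply (𝕜 := ℝ) (b i)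
      exact h.comp_homeomorph ((Homeomorph.smulOfNeZero r hr).trans (Homeomorph.addLeft z))
    rw [integral_ball_mul_inner (hcomp i) hcs (b i)]
    congr 2
    ext y
    congr 1
    have hd : HasFDerivAt (fun y : V => z + r • y) (r • ContinuousLinearMap.id ℝ V) y :=
      ((hasFDerivAt_id y).const_smul r).const_add z
    have := ((((hv.fderiv_const_apply (b i)).differentiable (by simp))
      (z + r • y)).hasFDerivAt.comp y hd).fderiv
    simp only [Function.comp_def] at this
    rw [this]
    simp
  simp_rw [h1]
  rw [integral_finsetSum]
  · simp_rw [h2, traceHessian, Finset.sum_mul]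
    rw [integral_finsetSum, Finset.mul_sum]
    · refine Finset.sum_congr rfl fun i _ => ?_
      simp_rw [mul_assoc r, integral_const_mul]
      ring
    · intro i _
      refine integrableOn_ball_of_continuous ?_ _ _
      exact ((((hv.fderiv_const_apply (b i)).continuous_fderiv (by simp)).comp
        haff.continuous).clm_apply continuous_const).mul (by fun_prop)
  · intro i _
    refine integrableOn_ball_of_continuous ?_ _ _
    exact (hcomp i).continuous.mul (by fun_prop)

lemma hasDerivAt_ballIncrement {v : V → ℝ} (hv : ContDiff ℝ 2 v) (hc : HasCompactSupport v)
    (z : V) {r : ℝ} (hr : r ≠ 0) :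
    HasDerivAt (ballIncrement μ v z)
      (r / 2 * ∫ y in ball (0 : V) 1, traceHessian v (z + r • y) * (1 - ‖y‖ ^ 2) ∂μ) r := by
  rw [← integral_ball_fderiv_apply hv hc z hr]
  have hcd : Continuous (fderiv ℝ v) := hv.continuous_fderiv (by simp)
  obtain ⟨C, hC⟩ := hcd.bounded_above_of_compact_support (hc.fderiv (𝕜 := ℝ))
  refine (hasDerivAt_integral_of_dominated_loc_of_deriv_le (μ := μ.restrict (ball (0 : V) 1))
    (F := fun s y => v (z + s • y) - v z) (F' := fun s y => fderiv ℝ v (z + s • y) y)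
    (bound := fun _ => C) (s := univ) univ_mem ?_ ?_ ?_ ?_ ?_ ?_).2
  · refine Eventually.of_forall fun s => Continuous.aestronglyMeasurable ?_
    have := hv.continuous
    fun_prop
  · refine integrableOn_ball_of_continuous ?_ _ _
    have := hv.continuous
    fun_prop
  · refine Continuous.aestronglyMeasurable ?_
    exact (hcd.comp (by fun_prop)).clm_apply continuous_id
  · refine (ae_restrict_iff' measurableSet_ball).2 (Eventually.of_forall fun y hy s _ => ?_)
    have hy1 : ‖y‖ ≤ 1 := by simpa using (mem_ball.1 hy).le
    calc ‖fderiv ℝ v (z + s • y) y‖ ≤ ‖fderiv ℝ v (z + s • y)‖ * ‖y‖ :=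
          ContinuousLinearMap.le_opNorm _ _
      _ ≤ C * 1 := mul_le_mul (hC _) hy1 (norm_nonneg _) ((norm_nonneg _).trans (hC z))
      _ = C := mul_one C
  · exact integrableOn_ball_of_continuous continuous_const _ _
  · refine Eventually.of_forall fun y s _ => ?_
    have hd : HasDerivAt (fun s : ℝ => z + s • y) y s := by
      simpa using ((hasDerivAt_id s).smul_const y).const_add z
    exact (((hv.differentiable (by simp)) (z + s • y)).hasFDerivAt.comp_hasDerivAt s hd).sub_const
      (v z)

lemma continuous_ballIncrement {f : V → ℝ} (hf : Continuous f) (z : V) :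
    Continuous (ballIncrement μ f z) := by
  have h : ballIncrement μ f z = fun r =>
      ∫ y in closedBall (0 : V) 1, (f (z + r • y) - f z) ∂μ := by
    ext r
    refine setIntegral_congr_set ?_
    rw [← ball_union_sphere]
    exact (union_ae_eq_left_of_ae_eq_empty
      (ae_eq_empty.2 (Measure.addHaar_sphere_of_ne_zero μ 0 one_ne_zero))).symm
  rw [h]
  exact continuous_parametric_integral_of_continuous (by fun_prop) (isCompact_closedBall _ _)

lemma le_ballIncrement_of_le_traceHessian {v : V → ℝ} (hv : ContDiff ℝ 2 v)
    (hc : HasCompactSupport v) {z : V} {R c : ℝ} (h : ∀ y ∈ ball z R, c ≤ traceHessian v y)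
    {r : ℝ} (hr0 : 0 ≤ r) (hr : r < R) :
    c * r ^ 2 / 4 * ∫ y in ball (0 : V) 1, (1 - ‖y‖ ^ 2) ∂μ ≤ ballIncrement μ v z r := by
  set K := ∫ y in ball (0 : V) 1, (1 - ‖y‖ ^ 2) ∂μ
  have hder : ∀ s : ℝ, s ≠ 0 → HasDerivAt
      (fun s => ballIncrement μ v z s - c * s ^ 2 / 4 * K)
      (s / 2 * (∫ y in ball (0 : V) 1, traceHessian v (z + s • y) * (1 - ‖y‖ ^ 2) ∂μ)
        - c * (2 * s) / 4 * K) s := fun s hs => by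
    have := (hasDerivAt_ballIncrement (μ := μ) hv hc z hs).sub
      ((((hasDerivAt_pow 2 s).const_mul c).div_const 4).mul_const K)
    exact this.congr_deriv (by simp)
  have hmono : MonotoneOn (fun s => ballIncrement μ v z s - c * s ^ 2 / 4 * K) (Ico 0 R) := by
    refine monotoneOn_of_deriv_nonneg (convex_Ico 0 R) ?_ ?_ ?_
    · have := continuous_ballIncrement (μ := μ) hv.continuous z
      exact Continuous.continuousOn (by fun_prop)
    · rw [interior_Ico]
      exact fun s hs => (hder s hs.1.ne').differentiableAt.differentiableWithinAt
    · rw [interior_Ico]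
      intro s hs
      rw [(hder s hs.1.ne').deriv]
      have hle : c * K ≤ ∫ y in ball (0 : V) 1, traceHessian v (z + s • y) * (1 - ‖y‖ ^ 2) ∂μ := by
        rw [← integral_const_mul]
        refine setIntegral_mono_on (integrableOn_ball_of_continuous (by fun_prop) _ _)
          (integrableOn_ball_of_continuous ?_ _ _) measurableSet_ball fun y hy => ?_
        · have := continuous_traceHessian hv
          fun_prop
        · have hy1 : ‖y‖ < 1 := by simpa using hy
          refine mul_le_mul_of_nonneg_right (h _ ?_) (by nlinarith [norm_nonneg y])
          rw [mem_ball_iff_norm, add_sub_cancel_left, norm_smul, Real.norm_of_nonneg hs.1.le]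
          nlinarith [hs.1, hs.2]
      have := mul_le_mul_of_nonneg_left hle (by linarith [hs.1] : 0 ≤ s / 2)
      linarith
  have := hmono ⟨le_rfl, hr0.trans_lt hr⟩ ⟨hr0, hr⟩ hr0
  simp only [ballIncrement, zero_smul, add_zero, sub_self, integral_zero] at this
  simp only [ballIncrement]
  linarith

lemma integral_ball_one_sub_norm_sq_pos :
    0 < ∫ y in ball (0 : V) 1, (1 - ‖y‖ ^ 2) ∂μ := by
  have hlt : ∀ y ∈ ball (0 : V) 1, 0 < 1 - ‖y‖ ^ 2 := fun y hy => by
    have : ‖y‖ < 1 := by simpa using hy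
    nlinarith [norm_nonneg y]
  rw [setIntegral_pos_iff_support_of_nonneg_ae]
  · refine (measure_ball_pos μ (0 : V) one_pos).trans_le (measure_mono fun y hy => ?_)
    exact ⟨(hlt y hy).ne', hy⟩
  · exact (ae_restrict_iff' measurableSet_ball).2 (Eventually.of_forall fun y hy => (hlt y hy).le)
  · exact integrableOn_ball_of_continuous (by fun_prop) _ _

lemma traceHessian_nonneg_of_eventually {v : V → ℝ} (hv : ContDiff ℝ 2 v)
    (hc : HasCompactSupport v) {z : V}
    (h : ∀ ε > 0, ∀ᶠ r in 𝓝[>] (0 : ℝ), -ε * r ^ 2 ≤ ballIncrement μ v z r) :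
    0 ≤ traceHessian v z := by
  by_contra! hneg
  set c := -traceHessian v z / 2 with hcdef
  have hc0 : 0 < c := by linarith
  obtain ⟨R, hR, hball⟩ := Metric.eventually_nhds_iff_ball.1
    ((continuous_traceHessian hv).continuousAt.eventually
      (gt_mem_nhds (show traceHessian v z < -c by linarith)))
  set K := ∫ y in ball (0 : V) 1, (1 - ‖y‖ ^ 2) ∂μ with hK
  have hKpos : 0 < K := integral_ball_one_sub_norm_sq_pos
  obtain ⟨r, hrε, hr0, hrR⟩ := ((h (c * K / 8) (by positivity)).and
    (Ioo_mem_nhdsGT hR)).exists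
  have h1 := le_ballIncrement_of_le_traceHessian (μ := μ) (v := fun y => -v y) hv.neg hc.neg
    (z := z) (R := R) (c := c)
    (fun y hy => by rw [traceHessian_neg]; linarith [hball y hy]) hr0.le hrR
  have h2 : ballIncrement μ (fun y => -v y) z r = -ballIncrement μ v z r := by
    simp only [ballIncrement]
    rw [← integral_neg]
    congr 1
    ext y
    ring
  rw [h2, ← hK] at h1
  have : 0 < c * K * r ^ 2 := by positivity
  linarith

lemma ballIncrement_convolution {f η : V → ℝ} (hf : Continuous f) (hfc : HasCompactSupport f)
    (hη : Continuous η) (hηc : HasCompactSupport η) (z : V) (r : ℝ) :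
    ballIncrement μ (η ⋆[ContinuousLinearMap.lsmul ℝ ℝ, μ] f) z r
      = ∫ t, η t * ballIncrement μ f (z - t) r ∂μ := by
  obtain ⟨C, hC⟩ := hf.bounded_above_of_compact_support hfc
  have hηi : Integrable η μ := hη.integrable_of_hasCompactSupport hηc
  have hi : ∀ x, Integrable (fun t => η t * f (x - t)) μ := fun x =>
    hηi.mul_bdd (c := C) (Continuous.aestronglyMeasurable (by fun_prop))
      (Eventually.of_forall fun t => hC _)
  have h1 : ∀ y, (η ⋆[ContinuousLinearMap.lsmul ℝ ℝ, μ] f) (z + r • y)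
      - (η ⋆[ContinuousLinearMap.lsmul ℝ ℝ, μ] f) z
      = ∫ t, η t * (f (z - t + r • y) - f (z - t)) ∂μ := fun y => by
    simp only [convolution_def, ContinuousLinearMap.lsmul_apply, smul_eq_mul]
    rw [← integral_sub (hi _) (hi _)]
    congr 1
    ext t
    rw [show z + r • y - t = z - t + r • y by abel]
    ring
  simp only [ballIncrement, h1]
  rw [integral_integral_swap]
  · simp_rw [integral_const_mul]
  · have : IsFiniteMeasure (μ.restrict (ball (0 : V) 1)) := ⟨by
      simpa using measure_ball_lt_top⟩
    refine (hηi.comp_snd (μ.restrict (ball (0 : V) 1))).mul_bdd (c := C + C) ?_ ?_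
    · exact Continuous.aestronglyMeasurable (by fun_prop)
    · exact Eventually.of_forall fun p => (norm_sub_le _ _).trans (add_le_add (hC _) (hC _))

lemma eventually_le_ballIncrement_convolution {f η : V → ℝ} (hf : Continuous f)
    (hfc : HasCompactSupport f) (hη : Continuous η) (hηc : HasCompactSupport η)
    (hη0 : ∀ t, 0 ≤ η t) {z : V} {r₀ C : ℝ} (hr₀ : 0 < r₀) (hC0 : 0 ≤ C)
    (hC : ∀ t ∈ Function.support η, ∀ r, 0 < r → r < r₀ → -C * r ^ 2 ≤ ballIncrement μ f (z - t) r)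
    (hae : ∀ᵐ t ∂μ, t ∈ Function.support η → ∀ᶠ r in 𝓝[>] (0 : ℝ), 0 ≤ ballIncrement μ f (z - t) r)
    {ε : ℝ} (hε : 0 < ε) :
    ∀ᶠ r in 𝓝[>] (0 : ℝ),
      -ε * r ^ 2 ≤ ballIncrement μ (η ⋆[ContinuousLinearMap.lsmul ℝ ℝ, μ] f) z r := by
  have hηi : Integrable η μ := hη.integrable_of_hasCompactSupport hηc
  have hcont : ∀ r, Continuous (fun t => ballIncrement μ f (z - t) r) := fun r => by
    obtain ⟨M, hM⟩ := hf.bounded_above_of_compact_support hfc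
    have : IsFiniteMeasure (μ.restrict (ball (0 : V) 1)) := ⟨by
      simpa using measure_ball_lt_top⟩
    refine continuous_of_dominated (bound := fun _ => M + M) ?_ ?_ (integrable_const _) ?_
    · exact fun t => Continuous.aestronglyMeasurable (by fun_prop)
    · exact fun t => Eventually.of_forall fun y =>
        (norm_sub_le _ _).trans (add_le_add (hM _) (hM _))
    · exact Eventually.of_forall fun y => by fun_prop
  have hIoo : ∀ᶠ r in 𝓝[>] (0 : ℝ), 0 < r ∧ r < r₀ := Ioo_mem_nhdsGT hr₀
  have hlim : Tendsto (fun r : ℝ => ∫ t, η t * min 0 (ballIncrement μ f (z - t) r / r ^ 2) ∂μ)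
      (𝓝[>] 0) (𝓝 (∫ _, (0 : ℝ) ∂μ)) := by
    refine tendsto_integral_filter_of_dominated_convergence (fun t => η t * C) ?_ ?_ ?_ ?_
    · refine Eventually.of_forall fun r => Continuous.aestronglyMeasurable ?_
      have := hcont r
      fun_prop
    · filter_upwards [hIoo] with r hr
      refine Eventually.of_forall fun t => ?_
      rw [norm_mul, Real.norm_of_nonneg (hη0 t), Real.norm_of_nonpos (min_le_left _ _)]
      by_cases ht : t ∈ Function.support η
      · refine mul_le_mul_of_nonneg_left ?_ (hη0 t)
        have : -C ≤ min 0 (ballIncrement μ f (z - t) r / r ^ 2) := by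
          refine le_min (by linarith) ?_
          rw [le_div_iff₀ (by have := hr.1; positivity)]
          exact hC t ht r hr.1 hr.2
        linarith
      · simp [Function.notMem_support.1 ht]
    · exact hηi.mul_const C
    · filter_upwards [hae] with t ht
      by_cases hts : t ∈ Function.support η
      · refine tendsto_const_nhds.congr' ?_
        filter_upwards [ht hts] with r hr
        rw [min_eq_left (by positivity), mul_zero]
      · simp [Function.notMem_support.1 hts]
  rw [integral_zero] at hlim
  filter_upwards [hlim.eventually (lt_mem_nhds (neg_lt_zero.2 hε)), hIoo] with r hr hr0
  have hr2 : 0 < r ^ 2 := by have := hr0.1; positivity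
  rw [ballIncrement_convolution hf hfc hη hηc]
  refine (mul_le_mul_of_nonneg_right hr.le hr2.le).trans ?_
  rw [← integral_mul_const]
  have hprod : ∀ g : V → ℝ, Continuous g → Integrable (fun t => η t * g t) μ := fun g hg =>
    (hη.mul hg).integrable_of_hasCompactSupport hηc.mul_right
  refine integral_mono ((hprod _ ?_).mul_const _) (hprod _ (hcont r)) fun t => ?_
  · have := hcont r
    fun_prop
  · simp only []
    rw [mul_assoc]
    refine mul_le_mul_of_nonneg_left ?_ (hη0 t)
    calc _ ≤ ballIncrement μ f (z - t) r / r ^ 2 * r ^ 2 :=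
          mul_le_mul_of_nonneg_right (min_le_right _ _) hr2.le
      _ = _ := div_mul_cancel₀ _ hr2.ne'

/-- A continuous function whose ball means are bounded below to second order, and which satisfies
the sub-mean value inequality for small balls at almost every center, satisfies it at every
center. -/
theorem ballIncrement_nonneg_of_ae {f : V → ℝ} (hf : Continuous f) (hfc : HasCompactSupport f)
    {x : V} {ρ r₀ C : ℝ} (hr₀ : 0 < r₀) (hC0 : 0 ≤ C)
    (hC : ∀ y ∈ ball x ρ, ∀ r, 0 < r → r < r₀ → -C * r ^ 2 ≤ ballIncrement μ f y r)
    (hae : ∀ᵐ y ∂μ, y ∈ ball x ρ → ∀ᶠ r in 𝓝[>] (0 : ℝ), 0 ≤ ballIncrement μ f y r)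
    {r : ℝ} (hr0 : 0 ≤ r) (hr : r < ρ) : 0 ≤ ballIncrement μ f x r := by
  let φ : ℕ → ContDiffBump (0 : V) := fun n =>
    ⟨1 / (n + 1) / 2, 1 / (n + 1), by positivity, half_lt_self (by positivity)⟩
  have hφ : Tendsto (fun n => (φ n).rOut) atTop (𝓝 0) := tendsto_one_div_add_atTop_nhds_zero_nat
  have hlim : Tendsto (fun n => ballIncrement μ
      ((φ n).normed μ ⋆[ContinuousLinearMap.lsmul ℝ ℝ, μ] f) x r) atTop
      (𝓝 (ballIncrement μ f x r)) := by
    obtain ⟨M, hM⟩ := hf.bounded_above_of_compact_support hfc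
    have : IsFiniteMeasure (μ.restrict (ball (0 : V) 1)) := ⟨by
      simpa using measure_ball_lt_top⟩
    have hcv : ∀ n, Continuous ((φ n).normed μ ⋆[ContinuousLinearMap.lsmul ℝ ℝ, μ] f) := fun n =>
      (φ n).hasCompactSupport_normed.continuous_convolution_left _ (φ n).continuous_normed
        hf.locallyIntegrable
    have hbd : ∀ n y, ‖((φ n).normed μ ⋆[ContinuousLinearMap.lsmul ℝ ℝ, μ] f) y‖ ≤ M :=
      fun n y => by
      rw [← dist_zero_right]
      refine dist_convolution_le (z₀ := (0 : ℝ)) (R := (φ n).rOut) ((norm_nonneg _).trans (hM 0))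
        (φ n).support_normed_eq.subset (φ n).nonneg_normed (φ n).integral_normed
        hf.aestronglyMeasurable fun y _ => ?_
      simpa using hM y
    refine tendsto_integral_of_dominated_convergence (fun _ => M + M) ?_ (integrable_const _) ?_ ?_
    · intro n
      have := hcv n
      exact Continuous.aestronglyMeasurable (by fun_prop)
    · exact fun n => Eventually.of_forall fun y =>
        (norm_sub_le _ _).trans (add_le_add (hbd _ _) (hbd _ _))
    · exact Eventually.of_forall fun y =>
        (ContDiffBump.convolution_tendsto_right_of_continuous hφ hf _).sub
          (ContDiffBump.convolution_tendsto_right_of_continuous hφ hf _)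
  refine ge_of_tendsto hlim ?_
  filter_upwards [hφ.eventually (gt_mem_nhds (sub_pos.2 hr))] with n hn
  have hv : ContDiff ℝ 2 ((φ n).normed μ ⋆[ContinuousLinearMap.lsmul ℝ ℝ, μ] f) :=
    (φ n).hasCompactSupport_normed.contDiff_convolution_left _ (φ n).contDiff_normed
      hf.locallyIntegrable
  have hvc : HasCompactSupport ((φ n).normed μ ⋆[ContinuousLinearMap.lsmul ℝ ℝ, μ] f) :=
    (φ n).hasCompactSupport_normed.convolution _ hfc
  have := le_ballIncrement_of_le_traceHessian (μ := μ) hv hvc (z := x) (R := ρ - (φ n).rOut)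
    (c := 0) (fun z hz => ?_) hr0 (by linarith)
  · simpa using this
  have hmem : ∀ t ∈ Function.support ((φ n).normed μ), z - t ∈ ball x ρ := fun t ht => by
    rw [(φ n).support_normed_eq, mem_ball_zero_iff] at ht
    rw [mem_ball_iff_norm] at hz ⊢
    calc ‖z - t - x‖ = ‖(z - x) - t‖ := by congr 1; abel
      _ ≤ ‖z - x‖ + ‖t‖ := norm_sub_le _ _
      _ < ρ := by linarith
  refine traceHessian_nonneg_of_eventually (μ := μ) hv hvc fun ε hε => ?_
  refine eventually_le_ballIncrement_convolution hf hfc (φ n).continuous_normed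
    (φ n).hasCompactSupport_normed (φ n).nonneg_normed hr₀ hC0
    (fun t ht => hC _ (hmem t ht)) ?_ hε
  filter_upwards [(quasiMeasurePreserving_sub_left μ z).ae hae] with t ht hts
  exact ht (hmem t hts)

lemma pow_mul_ballIncrement (f : V → ℝ) (z : V) {r : ℝ} (hr : 0 < r) :
    r ^ Module.finrank ℝ V * ballIncrement μ f z r = ∫ y in ball z r, (f y - f z) ∂μ := by
  have h := Measure.setIntegral_comp_smul_of_pos μ (fun v => f (z + v) - f z) (ball (0 : V) 1) hr
  rw [smul_unitBall_of_pos hr, smul_eq_mul] at h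
  have ht := (measurePreserving_add_left μ z).setIntegral_preimage_emb
    (measurableEmbedding_addLeft z) (fun y => f y - f z) (ball z r)
  rw [preimage_add_ball, sub_self] at ht
  rw [ballIncrement, h, ← ht, mul_inv_cancel_left₀ (by positivity)]

lemma integral_ball_inner_eq_zero (a : V) : ∫ y in ball (0 : V) 1, inner ℝ a y ∂μ = 0 := by
  have h := (Measure.measurePreserving_neg μ).setIntegral_preimage_emb
    (MeasurableEquiv.neg V).measurableEmbedding (fun y => inner ℝ a y) (ball (0 : V) 1)
  have hp : (Neg.neg : V → V) ⁻¹' ball 0 1 = ball 0 1 := by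
    ext y
    simp
  rw [hp] at h
  simp only [inner_neg_right, integral_neg] at h
  linarith

end BallIncrement

lemma neg_log_infDist_add_ge {V : Type*} [NormedAddCommGroup V] [InnerProductSpace ℝ V]
    [ProperSpace V] {F : Set V} (hF : IsClosed F) (hne : F.Nonempty) {y : V}
    (hy : 0 < infDist y F) :
    ∃ a : V, ∀ h : V, ‖h‖ < infDist y F →
      -Real.log (infDist y F) + inner ℝ a h - ‖h‖ ^ 2 / (2 * infDist y F ^ 2)
        ≤ -Real.log (infDist (y + h) F) := by
  obtain ⟨p, hp, hd⟩ := hF.exists_infDist_eq_dist hne y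
  set d := infDist y F with hddef
  refine ⟨-(d ^ 2)⁻¹ • (y - p), fun h hh => ?_⟩
  have hpos : 0 < infDist (y + h) F := by
    have := infDist_le_infDist_add_dist (s := F) (x := y) (y := y + h)
    rw [dist_self_add_right] at this
    linarith
  have hle : infDist (y + h) F ≤ ‖y - p + h‖ := by
    refine (infDist_le_dist_of_mem hp).trans_eq ?_
    rw [dist_eq_norm]
    congr 1
    abel
  have hN : 0 < ‖y - p + h‖ := hpos.trans_le hle
  have hnorm : ‖y - p‖ = d := by rw [hd, dist_eq_norm]
  have h1 : Real.log (infDist (y + h) F) ≤ Real.log ‖y - p + h‖ := Real.log_le_log hpos hle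
  have h2 : Real.log ((‖y - p + h‖ / d) ^ 2) ≤ (‖y - p + h‖ / d) ^ 2 - 1 :=
    Real.log_le_sub_one_of_pos (by positivity)
  rw [Real.log_pow, Real.log_div hN.ne' hy.ne'] at h2
  have h3 : (‖y - p + h‖ / d) ^ 2 - 1 = 2 * ((d ^ 2)⁻¹ * inner ℝ (y - p) h) + ‖h‖ ^ 2 / d ^ 2 := by
    rw [div_pow, norm_add_sq_real, hnorm]
    field_simp
    ring
  have h4 : ‖h‖ ^ 2 / (2 * d ^ 2) = ‖h‖ ^ 2 / d ^ 2 / 2 := by rw [div_div, mul_comm (2 : ℝ)]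
  rw [inner_smul_left, h4]
  simp only [conj_trivial]
  push_cast at h2
  linarith

lemma erealBallAvg_coe {V : Type*} [NormedAddCommGroup V] [ProperSpace V] [MeasureSpace V]
    [(volume : Measure V).IsOpenPosMeasure] [IsFiniteMeasureOnCompacts (volume : Measure V)] {g : V → ℝ} {y : V} {r : ℝ} (hr : 0 < r)
    (hg : IntegrableOn g (ball y r)) :
    erealBallAvg (fun z => (g z : EReal)) y r
      = (((∫ z in ball y r, g z) / volume.real (ball y r) : ℝ) : EReal) := by
  have hvol : volume (ball y r) ≠ 0 := (measure_ball_pos volume y hr).ne'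
  have hcoe : ∀ h : V → ℝ, IntegrableOn h (ball y r) →
      (((∫⁻ z in ball y r, erealToENNReal (h z : EReal)) / volume (ball y r) : ℝ≥0∞) : EReal)
        = (((∫⁻ z in ball y r, ENNReal.ofReal (h z)).toReal / volume.real (ball y r) : ℝ) :
          EReal) := fun h hh => by
    have h1 : ∀ t : ℝ, erealToENNReal (t : EReal) = ENNReal.ofReal t := fun t => by
      simp [erealToENNReal]
    simp_rw [h1]
    have hfin : (∫⁻ z in ball y r, ENNReal.ofReal (h z)) ≠ ⊤ := hh.lintegral_lt_top.ne
    rw [← EReal.coe_ennreal_toReal (ENNReal.div_ne_top hfin hvol), ENNReal.toReal_div]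
    rfl
  unfold erealBallAvg
  simp_rw [← EReal.coe_neg]
  rw [hcoe g hg, hcoe (fun z => -g z) hg.neg, ← EReal.coe_sub, ← sub_div,
    integral_eq_lintegral_pos_part_sub_lintegral_neg_part hg]

section Means

variable {V : Type*} [NormedAddCommGroup V] [InnerProductSpace ℝ V] [FiniteDimensional ℝ V]

lemma ballIncrement_neg_log_infDist_ge [MeasurableSpace V] [BorelSpace V] {μ : Measure V}
    [μ.IsAddHaarMeasure] {F : Set V} (hF : IsClosed F) (hne : F.Nonempty)
    {y : V} {δ : ℝ} (hδ : 0 < δ) (hy : δ ≤ infDist y F) {r : ℝ} (hr0 : 0 < r) (hr : r < δ) :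
    -(μ.real (ball (0 : V) 1) / (2 * δ ^ 2)) * r ^ 2
      ≤ ballIncrement μ (fun y => -Real.log (infDist y F)) y r := by
  obtain ⟨a, ha⟩ := neg_log_infDist_add_ge hF hne (hδ.trans_le hy)
  have hpos : ∀ w ∈ closedBall (0 : V) 1, 0 < infDist (y + r • w) F := fun w hw => by
    have := infDist_le_infDist_add_dist (s := F) (x := y) (y := y + r • w)
    rw [dist_self_add_right, norm_smul, Real.norm_of_nonneg hr0.le] at this
    have hw1 : ‖w‖ ≤ 1 := by simpa using hw
    nlinarith
  have hint : IntegrableOn (fun w => -Real.log (infDist (y + r • w) F) - -Real.log (infDist y F))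
      (ball (0 : V) 1) μ := by
    refine (ContinuousOn.integrableOn_compact (isCompact_closedBall (0 : V) 1) ?_).mono_set
      ball_subset_closedBall
    refine (ContinuousOn.neg (ContinuousOn.log ?_ fun w hw => (hpos w hw).ne')).sub
      continuousOn_const
    exact Continuous.continuousOn ((continuous_infDist_pt F).comp (by fun_prop))
  have hint' : IntegrableOn (fun w => r * inner ℝ a w - r ^ 2 / (2 * δ ^ 2)) (ball (0 : V) 1) μ :=
    integrableOn_ball_of_continuous (by fun_prop) _ _
  have hval : ∫ w in ball (0 : V) 1, (r * inner ℝ a w - r ^ 2 / (2 * δ ^ 2)) ∂μ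
      = -(μ.real (ball (0 : V) 1) / (2 * δ ^ 2)) * r ^ 2 := by
    rw [integral_sub (integrableOn_ball_of_continuous (by fun_prop) _ _)
      (integrableOn_ball_of_continuous (by fun_prop) _ _), integral_const_mul,
      integral_ball_inner_eq_zero, setIntegral_const, smul_eq_mul]
    ring
  rw [← hval]
  refine setIntegral_mono_on hint' hint measurableSet_ball fun w hw => ?_
  have hw1 : ‖w‖ < 1 := by simpa using hw
  have hn : ‖r • w‖ ≤ r := by
    rw [norm_smul, Real.norm_of_nonneg hr0.le]
    nlinarith
  have h1 := ha (r • w) (by linarith)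
  rw [inner_smul_right] at h1
  have h2 : ‖r • w‖ ^ 2 / (2 * infDist y F ^ 2) ≤ r ^ 2 / (2 * δ ^ 2) := by gcongr
  linarith

variable [MeasureSpace V] [BorelSpace V] [(volume : Measure V).IsAddHaarMeasure]

lemma le_erealBallAvg_iff {g : V → ℝ} {y : V} {r : ℝ} (hr : 0 < r)
    (hg : IntegrableOn g (ball y r)) :
    (g y : EReal) ≤ erealBallAvg (fun z => (g z : EReal)) y r ↔ 0 ≤ ballIncrement volume g y r := by
  have hvol : 0 < volume.real (ball y r) :=
    ENNReal.toReal_pos (measure_ball_pos volume y hr).ne' measure_ball_lt_top.ne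
  have hpow : 0 < r ^ Module.finrank ℝ V := by positivity
  rw [erealBallAvg_coe hr hg, EReal.coe_le_coe_iff, le_div_iff₀ hvol,
    ← mul_nonneg_iff_of_pos_left hpow, pow_mul_ballIncrement g y hr,
    integral_sub hg (integrableOn_ball_of_continuous continuous_const _ _), setIntegral_const,
    smul_eq_mul, sub_nonneg, mul_comm]

end Means

lemma infDist_frontier_pos {X : Type*} [PseudoMetricSpace X] {s : Set X} (hs : IsOpen s)
    (hF : (frontier s).Nonempty) {x : X} (hx : x ∈ s) : 0 < infDist x (frontier s) := by
  rw [← isClosed_frontier.notMem_iff_infDist_pos hF, hs.frontier_eq]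
  exact fun h => h.2 hx

lemma ball_infDist_frontier_subset {V : Type*} [NormedAddCommGroup V] [NormedSpace ℝ V]
    {s : Set V} (hs : IsOpen s) {x : V} (hx : x ∈ s) : ball x (infDist x (frontier s)) ⊆ s := by
  have hnot : ∀ y ∈ ball x (infDist x (frontier s)), y ∉ frontier s := fun y hy hyF =>
    (infDist_le_dist_of_mem hyF).not_gt (mem_ball'.1 hy)
  intro y hy
  by_contra hys
  have hcl : ∀ z ∈ ball x (infDist x (frontier s)), z ∉ s → z ∈ (closure s)ᶜ := fun z hz hzs hzc =>
    hnot z hz (by rw [hs.frontier_eq]; exact ⟨hzc, hzs⟩)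
  obtain ⟨z, -, hzs, hzc⟩ := (convex_ball x (infDist x (frontier s))).isPreconnected
    s (closure s)ᶜ hs isClosed_closure.isOpen_compl
    (fun z hz => or_iff_not_imp_left.2 (hcl z hz))
    ⟨x, mem_ball_self (dist_nonneg.trans_lt hy), hx⟩ ⟨y, hy, hcl y hy hys⟩
  exact hzc (subset_closure hzs)

/-- Theorem (statement 11): let `Ω ⊊ ℝᵐ` be a domain and `E ⊆ Ω` a closed subset of `Ω` of
Lebesgue measure zero. If `x ↦ -log(d_{∂Ω}(x))` is subharmonic on `Ω \ E`, then it is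
subharmonic on all of `Ω`. -/
theorem negLogDist_subharmonic_extend (m : ℕ) (Ω : Set (EuclideanSpace ℝ (Fin m)))
    (hopen : IsOpen Ω) (hconn : IsConnected Ω) (hne : Ω ≠ Set.univ)
    (Ecl : Set (EuclideanSpace ℝ (Fin m))) (hEsub : Ecl ⊆ Ω)
    (hEclosed : IsOpen (Ω \ Ecl)) (hEnull : volume Ecl = 0)
    (hsub : IsSubharmonicOn
      (fun x => ((- Real.log (infDist x (frontier Ω)) : ℝ) : EReal)) (Ω \ Ecl)) :
    IsSubharmonicOn (fun x => ((- Real.log (infDist x (frontier Ω)) : ℝ) : EReal)) Ω := by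

  set F := frontier Ω with hFdef
  have hFne : F.Nonempty := nonempty_frontier_iff.2 ⟨hconn.nonempty, hne⟩
  have hFcl : IsClosed F := isClosed_frontier
  have hpos : ∀ x ∈ Ω, 0 < infDist x F := fun x hx => infDist_frontier_pos hopen hFne hx
  set u : EuclideanSpace ℝ (Fin m) → ℝ := fun x => -Real.log (infDist x F) with hu
  have hucont : ContinuousOn u Ω :=
    ((continuous_infDist_pt F).continuousOn.log fun x hx => (hpos x hx).ne').neg
  have huint : ∀ y r, closedBall y r ⊆ Ω → IntegrableOn u (ball y r) := fun y r h =>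
    ((hucont.mono h).integrableOn_compact (isCompact_closedBall y r)).mono_set
      ball_subset_closedBall
  refine ⟨?_, ?_, fun x _ => EReal.coe_lt_top _, ?_⟩
  · exact (continuous_coe_real_ereal.comp_continuousOn hucont).upperSemicontinuousOn
  · obtain ⟨x, hx⟩ := hconn.nonempty
    exact fun h => EReal.coe_ne_bot _ (h x hx)
  intro x hx
  set d := infDist x F with hd
  have hd0 : 0 < d := hpos x hx
  have hballΩ : ball x d ⊆ Ω := ball_infDist_frontier_subset hopen hx
  refine ⟨d / 4, by positivity, fun r hr0 hr hrΩ => ?_⟩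
  refine (le_erealBallAvg_iff hr0 (huint x r hrΩ)).2 ?_
  let χ : ContDiffBump x := ⟨d / 2, 3 * d / 4, by positivity, by linarith⟩
  let f : EuclideanSpace ℝ (Fin m) → ℝ := fun y => χ y * -Real.log (max (infDist y F) (d / 4))
  have hdist : ∀ y, d - dist y x ≤ infDist y F := fun y => by
    have := infDist_le_infDist_add_dist (s := F) (x := x) (y := y)
    rw [dist_comm x y] at this
    linarith
  have hf : Continuous f := by
    refine χ.continuous.mul (Continuous.neg (Continuous.log ?_ fun y => ?_))
    · exact (continuous_infDist_pt F).max continuous_const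
    · exact (lt_max_of_lt_right (by positivity)).ne'
  have hfc : HasCompactSupport f := χ.hasCompactSupport.mul_right
  have hfu : ∀ y ∈ closedBall x (d / 2), f y = u y := fun y hy => by
    have h1 : χ y = 1 := χ.one_of_mem_closedBall hy
    have h2 : d / 4 ≤ infDist y F := by linarith [hdist y, mem_closedBall.1 hy]
    simp only [f, hu, h1, one_mul, max_eq_left h2]
  have hinc : ∀ y ∈ ball x (d / 4), ∀ s, 0 ≤ s → s ≤ d / 4 →
      ballIncrement volume f y s = ballIncrement volume u y s := fun y hy s hs0 hs => by
    rw [mem_ball] at hy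
    refine setIntegral_congr_fun measurableSet_ball fun w hw => ?_
    have hw1 : ‖w‖ < 1 := by simpa using hw
    have h1 : dist (y + s • w) y ≤ s := by
      rw [dist_self_add_left, norm_smul, Real.norm_of_nonneg hs0]
      nlinarith
    have h2 : dist (y + s • w) x ≤ d / 2 := by
      linarith [dist_triangle (y + s • w) y x]
    rw [hfu y (mem_closedBall.2 (by linarith)), hfu _ (mem_closedBall.2 h2)]
  rw [← hinc x (mem_ball_self (by positivity)) r hr0.le hr.le]
  refine ballIncrement_nonneg_of_ae (ρ := d / 4) (r₀ := d / 4) hf hfc (by positivity)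
    (C := volume.real (ball (0 : EuclideanSpace ℝ (Fin m)) 1) / (2 * (d / 2) ^ 2))
    (by positivity) ?_ ?_ hr0.le hr
  · intro y hy s hs0 hs
    rw [hinc y hy s hs0.le hs.le]
    exact ballIncrement_neg_log_infDist_ge hFcl hFne (by positivity)
      (by linarith [hdist y, mem_ball.1 hy]) hs0 (by linarith)
  · filter_upwards [measure_eq_zero_iff_ae_notMem.1 hEnull] with y hyE hy
    have hyΩ : y ∈ Ω \ Ecl := ⟨hballΩ (ball_subset_ball (by linarith) hy), hyE⟩
    obtain ⟨R, hR, hsm⟩ := hsub.2.2.2 y hyΩ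
    obtain ⟨ε, hε, hεs⟩ := Metric.isOpen_iff.1 hEclosed y hyΩ
    filter_upwards [Ioo_mem_nhdsGT hR, Ioo_mem_nhdsGT hε,
      Ioo_mem_nhdsGT (show 0 < d / 4 by positivity)] with s hsR hsε hsd
    have hcb : closedBall y s ⊆ Ω \ Ecl := (closedBall_subset_ball hsε.2).trans hεs
    rw [hinc y hy s hsd.1.le hsd.2.le,
      ← le_erealBallAvg_iff hsR.1 (huint y s (hcb.trans sdiff_subset))]
    exact hsm s hsR.1 hsR.2 hcb

end
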